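/- In the same setting as the previous lemma (weights T summing to 1, T_L the ℓ lightest with sum(T_L) ≥ ε/2, α_ℓ ≤ κ/10, H the heavy elements, T' a uniformly random subset of T \ (H ∪ {α_ℓ})): if ε/2 ≤ sum(T_L) < 20ε, then with probability at least 1 − δ/M, sum(T'_L ∪ {α_ℓ}) / sum(T' ∪ {α_ℓ}) ≥ sum(T_L)·(1 − ρ), where ρ = (ln 2)/M. -/

import Mathlib

open Finset

/-- The normalised moment generating function of a fair `{0, 1}` variable is subgaussian. -/
lemma one_add_exp_neg_le (x : ℝ) :
    1 + Real.exp (-x) ≤ 2 * Real.exp (-x / 2 + x ^ 2 / 8) := by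
  have h := Real.cosh_le_exp_half_sq (x / 2)
  rw [Real.cosh_eq] at h
  have h1 : Real.exp (-x / 2) * Real.exp (x / 2) = 1 := by
    rw [← Real.exp_add, ← Real.exp_zero]
    congr 1
    ring
  have h2 : Real.exp (-x / 2) * Real.exp (-(x / 2)) = Real.exp (-x) := by
    rw [← Real.exp_add]
    congr 1
    ring
  have h3 := mul_le_mul_of_nonneg_left h (Real.exp_pos (-x / 2)).le
  have h4 : (x / 2) ^ 2 / 2 = x ^ 2 / 8 := by ring
  rw [Real.exp_add, ← h4]
  linarith

/-- The sum of `exp (-t ∑ w)` over all subsets is at most its subgaussian bound. -/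
lemma sum_powerset_exp_neg_le {ι : Type*} (B : Finset ι) (w : ι → ℝ) (t : ℝ) :
    ∑ S ∈ B.powerset, Real.exp (-(t * ∑ i ∈ S, w i)) ≤
      2 ^ #B * Real.exp (-t * (∑ i ∈ B, w i) / 2 + t ^ 2 * (∑ i ∈ B, w i ^ 2) / 8) := by
  classical
  calc ∑ S ∈ B.powerset, Real.exp (-(t * ∑ i ∈ S, w i))
      = ∏ i ∈ B, (1 + Real.exp (-(t * w i))) := by
        rw [Finset.prod_one_add]
        refine Finset.sum_congr rfl fun S _ => ?_
        rw [← Real.exp_sum, Finset.sum_neg_distrib, Finset.mul_sum]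
    _ ≤ ∏ i ∈ B, (2 * Real.exp (-(t * w i) / 2 + (t * w i) ^ 2 / 8)) :=
        Finset.prod_le_prod (fun i _ => by positivity) fun i _ => one_add_exp_neg_le _
    _ = _ := by
        rw [Finset.prod_mul_distrib, Finset.prod_const, ← Real.exp_sum, Finset.sum_add_distrib,
          ← Finset.sum_div, ← Finset.sum_div, Finset.sum_neg_distrib, ← Finset.mul_sum]
        simp only [mul_pow]
        rw [← Finset.mul_sum, neg_mul]

/-- Hoeffding's inequality for the sum of a uniformly random subset. -/
lemma card_filter_sum_add_neg_le {ι : Type*} (B : Finset ι) (w : ι → ℝ) {d g V : ℝ}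
    (hg : 0 ≤ g) (hV : 0 < V) (hmean : g ≤ d + (∑ i ∈ B, w i) / 2)
    (hvar : ∑ i ∈ B, w i ^ 2 ≤ V) :
    (#{S ∈ B.powerset | ∑ i ∈ S, w i + d < 0} : ℝ) ≤ 2 ^ #B * Real.exp (-(2 * g ^ 2 / V)) := by
  set t := 4 * g / V with ht
  have ht0 : 0 ≤ t := by positivity
  calc (#{S ∈ B.powerset | ∑ i ∈ S, w i + d < 0} : ℝ)
      = ∑ S ∈ B.powerset with ∑ i ∈ S, w i + d < 0, (1 : ℝ) := by simp
    _ ≤ ∑ S ∈ B.powerset with ∑ i ∈ S, w i + d < 0,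
          Real.exp (-(t * d)) * Real.exp (-(t * ∑ i ∈ S, w i)) := by
        refine Finset.sum_le_sum fun S hS => ?_
        rw [← Real.exp_add]
        refine Real.one_le_exp ?_
        have := mul_nonneg ht0 (neg_nonneg.2 (Finset.mem_filter.1 hS).2.le)
        linarith
    _ ≤ ∑ S ∈ B.powerset, Real.exp (-(t * d)) * Real.exp (-(t * ∑ i ∈ S, w i)) :=
        Finset.sum_le_sum_of_subset_of_nonneg (Finset.filter_subset _ _)
          fun _ _ _ => by positivity
    _ = Real.exp (-(t * d)) * ∑ S ∈ B.powerset, Real.exp (-(t * ∑ i ∈ S, w i)) := by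
        rw [Finset.mul_sum]
    _ ≤ Real.exp (-(t * d)) * (2 ^ #B *
          Real.exp (-t * (∑ i ∈ B, w i) / 2 + t ^ 2 * (∑ i ∈ B, w i ^ 2) / 8)) :=
        mul_le_mul_of_nonneg_left (sum_powerset_exp_neg_le B w t) (Real.exp_pos _).le
    _ = 2 ^ #B * Real.exp (-(t * d) +
          (-t * (∑ i ∈ B, w i) / 2 + t ^ 2 * (∑ i ∈ B, w i ^ 2) / 8)) := by
        rw [Real.exp_add (-(t * d))]
        ring
    _ ≤ 2 ^ #B * Real.exp (-(2 * g ^ 2 / V)) := by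
        have h1 := mul_le_mul_of_nonneg_left hmean ht0
        have h2 := mul_le_mul_of_nonneg_left hvar (sq_nonneg t)
        have h3 : -(2 * g ^ 2 / V) = -(t * g) + t ^ 2 * V / 8 := by
          rw [ht]
          field_simp
          ring
        gcongr
        rw [h3]
        linarith

/-- Random-subset rank-preservation lemma, case `ε/2 ≤ sum(T_L) < 20ε`: there is
a small absolute constant `c > 0` such that in the stated setting, with
probability at least `1 − δ/M` over the uniformly random subset `T'` of
`T \ (H ∪ {α_ℓ})`, we have
`sum(T'_L ∪ {α_ℓ}) / sum(T' ∪ {α_ℓ}) ≥ sum(T_L)·(1 − ρ)` with `ρ = ln 2 / M`. -/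
theorem random_subset_rank_case_small :
    ∃ c : ℝ, 0 < c ∧
      ∀ (M δ ε κ : ℝ) (n : ℕ) (α : Fin n → ℝ) (ℓ : Fin n) (H : Finset (Fin n)),
        0 < M → 0 < δ → δ < 1 → 0 < ε → ε ≤ c → 0 < κ →
        Real.log (2*M/δ) ≤ (Real.log 2 / M)^2 * ε / (6*κ) →
        StrictMono α → (∀ i, 0 < α i) → (∑ i, α i = 1) →
        ε/2 ≤ ∑ i ∈ Finset.Iic ℓ, α i → α ℓ ≤ κ/10 →
        (∀ j, κ ≤ α j → j ∈ H) → (∀ j ∈ H, κ/2 ≤ α j) →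
        (∑ i ∈ Finset.Iic ℓ, α i) < 20*ε →
        (let base : Finset (Fin n) := Finset.univ \ insert ℓ H
         1 - δ/M ≤
          ((base.powerset.filter (fun S =>
              (∑ i ∈ Finset.Iic ℓ, α i) * (1 - Real.log 2 / M) ≤
                (∑ i ∈ S ∩ Finset.Iic ℓ, α i + α ℓ) /
                (∑ i ∈ S, α i + α ℓ))).card : ℝ) / 2^(base.card)) := by
  refine ⟨1 / 1000, by norm_num, ?_⟩
  intro M δ ε κ n α ℓ H hM hδ hδ1 hε hεc hκ hlog hmono hpos hsum hL hℓ hH1 hH2 hL20 base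
  set L := ∑ i ∈ Finset.Iic ℓ, α i with hLdef
  set ρ := Real.log 2 / M with hρdef
  have hρ : 0 < ρ := div_pos (Real.log_pos (by norm_num)) hM
  have hL0 : 0 < L := by linarith
  have hL1 : L < 1 / 50 := by linarith
  set good : Finset (Fin n) → Prop := fun S =>
    L * (1 - ρ) ≤ (∑ i ∈ S ∩ Finset.Iic ℓ, α i + α ℓ) / (∑ i ∈ S, α i + α ℓ) with hgood
  have hden (S : Finset (Fin n)) : 0 < ∑ i ∈ S, α i + α ℓ :=
    add_pos_of_nonneg_of_pos (Finset.sum_nonneg fun i _ => (hpos i).le) (hpos ℓ)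
  suffices hbad : (#{S ∈ base.powerset | ¬ good S} : ℝ) ≤ 2 ^ #base * (δ / M) by
    have hcard := Finset.card_filter_add_card_filter_not (s := base.powerset) good
    rw [Finset.card_powerset] at hcard
    have hcard' : (#{S ∈ base.powerset | good S} : ℝ) + #{S ∈ base.powerset | ¬ good S} =
        2 ^ #base := by exact_mod_cast hcard
    rw [le_div_iff₀ (by positivity)]
    linarith
  rcases lt_or_ge 1 ρ with hρ1 | hρ1
  · have hempty : #{S ∈ base.powerset | ¬ good S} = 0 := by
      rw [Finset.card_eq_zero, Finset.filter_eq_empty_iff]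
      intro S _
      rw [not_not]
      refine (mul_nonpos_of_nonneg_of_nonpos hL0.le (by linarith)).trans ?_
      exact div_nonneg (add_nonneg (Finset.sum_nonneg fun i _ => (hpos i).le) (hpos ℓ).le)
        (hden S).le
    rw [hempty, Nat.cast_zero]
    positivity
  set s := L * (1 - ρ) with hs
  have hs0 : 0 ≤ s := mul_nonneg hL0.le (by linarith)
  have hsL : s ≤ L := by nlinarith
  let w : Fin n → ℝ := fun i => (if i ∈ Finset.Iic ℓ then α i else 0) - s * α i
  have hsplit (S : Finset (Fin n)) :
      ∑ i ∈ S, w i = ∑ i ∈ S ∩ Finset.Iic ℓ, α i - s * ∑ i ∈ S, α i := by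
    simp only [w]
    rw [Finset.sum_sub_distrib, Finset.sum_ite_mem, ← Finset.mul_sum]
  have hnotH {i : Fin n} (hi : i ≤ ℓ) : i ∉ H := fun hiH => by
    have h1 := hH2 i hiH
    have h2 := hmono.monotone hi
    linarith
  have hsub : (#{S ∈ base.powerset | ¬ good S} : ℝ) ≤
      #{S ∈ base.powerset | ∑ i ∈ S, w i + (1 - s) * α ℓ < 0} := by
    refine Nat.cast_le.2 (Finset.card_le_card ?_)
    refine Finset.monotone_filter_right _ fun S _ hS => ?_
    have hS' := not_le.1 hS
    rw [div_lt_iff₀ (hden S)] at hS'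
    rw [hsplit]
    linarith
  have hmean : L * ρ / 2 ≤ (1 - s) * α ℓ + (∑ i ∈ base, w i) / 2 := by
    have htot : ∑ i, w i = L * ρ := by
      rw [hsplit, Finset.univ_inter, hsum, ← hLdef, hs]
      ring
    have hins : ∑ i ∈ insert ℓ H, w i ≤ (1 - s) * α ℓ := by
      rw [Finset.sum_insert (hnotH le_rfl)]
      have hH : ∑ i ∈ H, w i ≤ 0 := Finset.sum_nonpos fun i hi => by
        have hiℓ : ¬ i ≤ ℓ := fun h => hnotH h hi
        have := mul_nonneg hs0 (hpos i).le
        simp [w, hiℓ, this]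
      have hwℓ : w ℓ = (1 - s) * α ℓ := by
        simp only [w, Finset.mem_Iic, le_refl, if_true]
        ring
      linarith
    have hbase : ∑ i ∈ base, w i + ∑ i ∈ insert ℓ H, w i = ∑ i, w i :=
      Finset.sum_sdiff (Finset.subset_univ _)
    have : 0 ≤ (1 - s) * α ℓ := mul_nonneg (by linarith) (hpos ℓ).le
    linarith
  have hvar : ∑ i ∈ base, w i ^ 2 ≤ L * κ := by
    have hterm : ∀ i ∈ base,
        w i ^ 2 ≤ κ * (if i ∈ Finset.Iic ℓ then α i else 0) / 2 + κ * L ^ 2 * α i := by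
      intro i hi
      have hiH : i ∉ H := fun h =>
        (Finset.mem_sdiff.1 hi).2 (Finset.mem_insert_of_mem h)
      have hiκ : α i < κ := lt_of_not_ge fun h => hiH (hH1 i h)
      have hsq : α i ^ 2 ≤ κ * α i := by nlinarith [hpos i]
      have hs2 : s ^ 2 ≤ L ^ 2 := by gcongr
      by_cases hiℓ : i ≤ ℓ
      · have h1 := hmono.monotone hiℓ
        have h2 : α i ^ 2 ≤ κ * α i / 10 := by nlinarith [hpos i]
        have h3 : (1 - s) ^ 2 ≤ 1 := by nlinarith
        have h4 : 0 ≤ κ * α i := mul_nonneg hκ.le (hpos i).le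
        have h5 : 0 ≤ κ * L ^ 2 * α i := by have := hpos i; positivity
        have h6 : w i ^ 2 = (1 - s) ^ 2 * α i ^ 2 := by
          simp only [w, Finset.mem_Iic, hiℓ, if_true]
          ring
        have h7 := mul_le_mul_of_nonneg_right h3 (sq_nonneg (α i))
        simp only [Finset.mem_Iic, hiℓ, if_true]
        linarith
      · have h1 : w i ^ 2 = s ^ 2 * α i ^ 2 := by
          simp only [w, Finset.mem_Iic, hiℓ, if_false]
          ring
        have h2 := mul_le_mul hs2 hsq (sq_nonneg (α i)) (sq_nonneg L)
        simp only [Finset.mem_Iic, hiℓ, if_false]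
        linarith
    calc ∑ i ∈ base, w i ^ 2
        ≤ ∑ i ∈ base, (κ * (if i ∈ Finset.Iic ℓ then α i else 0) / 2 + κ * L ^ 2 * α i) :=
          Finset.sum_le_sum hterm
      _ ≤ ∑ i, (κ * (if i ∈ Finset.Iic ℓ then α i else 0) / 2 + κ * L ^ 2 * α i) := by
          refine Finset.sum_le_sum_of_subset_of_nonneg (Finset.subset_univ _) fun i _ _ => ?_
          have := hpos i
          split_ifs <;> positivity
      _ = κ * L / 2 + κ * L ^ 2 := by
          rw [Finset.sum_add_distrib, ← Finset.sum_div, ← Finset.mul_sum, ← Finset.mul_sum,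
            Finset.sum_ite_mem, Finset.univ_inter, hsum, mul_one]
      _ ≤ L * κ := by nlinarith [mul_pos hκ hL0]
  refine hsub.trans ((card_filter_sum_add_neg_le base w (by positivity) (mul_pos hL0 hκ)
    hmean hvar).trans ?_)
  have hexp : Real.log (2 * M / δ) ≤ 2 * (L * ρ / 2) ^ 2 / (L * κ) := by
    refine hlog.trans ?_
    have h1 : 2 * (L * ρ / 2) ^ 2 / (L * κ) = ρ ^ 2 * (3 * L) / (6 * κ) := by
      field_simp
      ring
    rw [h1]
    gcongr
    linarith
  have hfinal : Real.exp (-(2 * (L * ρ / 2) ^ 2 / (L * κ))) ≤ δ / M := by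
    refine (Real.exp_le_exp.2 (neg_le_neg hexp)).trans ?_
    rw [Real.exp_neg, Real.exp_log (by positivity), inv_div]
    gcongr
    linarith
  gcongr
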